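/- For every t > 1 and K > 0 there is a constant C_3 = C_3(t,K) > 0 such that every Feigenbaum map f = h ∘ Q_t in the class K(t,K) satisfies f(0) = c_1(f) ≥ C_3. -/

import Mathlib

open Set MeasureTheory

/-- `Q_t(x) = -|x|^t`. -/
noncomputable def Qmap (t : ℝ) (x : ℝ) : ℝ := -(|x| ^ t)

/-- Nonlinearity `N(h) = h'' / (h')^2`. -/
noncomputable def Nonlin (h : ℝ → ℝ) (x : ℝ) : ℝ :=
  deriv (deriv h) x / (deriv h x) ^ 2

/-- Schwarzian derivative `S(h) = h'''/h' - (3/2)(h''/h')^2`. -/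
noncomputable def Schw (h : ℝ → ℝ) (x : ℝ) : ℝ :=
  deriv (deriv (deriv h)) x / deriv h x - 3 / 2 * (deriv (deriv h) x / deriv h x) ^ 2

/-- A unimodal map of `[-1,1]`: continuous, increasing on `[-1,0]`, decreasing
on `[0,1]`, even, fixing `-1` and sending `1` to `-1`. -/
def Unimodal (f : ℝ → ℝ) : Prop :=
  ContinuousOn f (Icc (-1) 1) ∧
  StrictMonoOn f (Icc (-1) 0) ∧
  StrictAntiOn f (Icc 0 1) ∧
  (∀ x ∈ Icc (-1 : ℝ) 1, f (-x) = f x) ∧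
  f (-1) = -1 ∧ f 1 = -1 ∧
  MapsTo f (Icc (-1) 1) (Icc (-1) 1)

/-- `h` is a `C³` diffeomorphism of `[-1,0]` onto its image (increasing, with
nonvanishing derivative) with nonpositive Schwarzian derivative. -/
def NegSchwDiffeo (h : ℝ → ℝ) : Prop :=
  ContDiffOn ℝ 3 h (Icc (-1) 0) ∧
  (∀ x ∈ Icc (-1 : ℝ) 0, 0 < deriv h x) ∧
  (∀ x ∈ Icc (-1 : ℝ) 0, Schw h x ≤ 0)

/-- The class `𝒰` of unimodal maps of the form `h ∘ Q_t`, `t > 1`, `h` a `C³`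
diffeomorphism with nonpositive Schwarzian derivative. -/
def InU (f : ℝ → ℝ) : Prop :=
  Unimodal f ∧
  ∃ t : ℝ, 1 < t ∧ ∃ h : ℝ → ℝ, NegSchwDiffeo h ∧
    ∀ x ∈ Icc (-1 : ℝ) 1, f x = h (Qmap t x)

/-- The period-doubling renormalization `α ∘ f² ∘ α⁻¹`, where `α` is the linear
map sending the fixed endpoint `q` of the restrictive interval to `-1`,
i.e. `α (x) = -x/q`. -/
noncomputable def Renorm2 (f : ℝ → ℝ) (q : ℝ) : ℝ → ℝ :=
  fun x => -(f^[2] (-q * x)) / q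

/-- `fs` is the sequence of successive period-doubling renormalizations of
`f = fs 0`: for each `k`, `fs k` is unimodal and renormalizable with return
time `2` via the symmetric interval `[-(|qs k|), |qs k|]`, whose endpoint
`qs k` is fixed by `(fs k)²`, and `fs (k+1)` is the rescaled return map. -/
def FeigSeq (f : ℝ → ℝ) (fs : ℕ → ℝ → ℝ) (qs : ℕ → ℝ) : Prop :=
  fs 0 = f ∧ ∀ k : ℕ,
    Unimodal (fs k) ∧
    0 < |qs k| ∧ |qs k| < 1 ∧
    (fs k)^[2] (qs k) = qs k ∧
    MapsTo ((fs k)^[2]) (Icc (-(|qs k|)) (|qs k|)) (Icc (-(|qs k|)) (|qs k|)) ∧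
    fs (k + 1) = Renorm2 (fs k) (qs k)

/-- A Feigenbaum map: every renormalization is defined and renormalizable with
return time `2`. -/
def Feigenbaum (f : ℝ → ℝ) : Prop := ∃ fs qs, FeigSeq f fs qs

/-- The periodic points `p 0 = -1`, `p 1 ∈ (0,1)` the fixed point of `f`, and
for `n ≥ 2`, `p n` the fixed point of `f^(2^(n-1))` lying strictly between
`-p (n-1)` and `0` or between `0` and `-p (n-1)`.  The interval `I n` is the
closed interval bounded by `p n` and `-p n`, of length `2 * |p n|`. -/
def FeigPoints (f : ℝ → ℝ) (p : ℕ → ℝ) : Prop :=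
  p 0 = -1 ∧ p 1 ∈ Ioo (0 : ℝ) 1 ∧ f (p 1) = p 1 ∧
  ∀ n : ℕ, 2 ≤ n →
    f^[2 ^ (n - 1)] (p n) = p n ∧ 0 < |p n| ∧ |p n| < |p (n - 1)|

/-- The intervals of the partition `η₀`: for an index `i = (s, n)` in
`ℤ ∪ {-0}` (encoded as `Bool × ℕ`, with `|i| = i.2`), `Jint p (true, n)` is the
right component `J n` of `I n \ I (n+1)` and `Jint p (false, n)` is the left
component `J (-n)`. -/
noncomputable def Jint (p : ℕ → ℝ) (i : Bool × ℕ) : Set ℝ :=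
  if i.1 = true then Ioc (|p (i.2 + 1)|) (|p i.2|)
  else Ico (-(|p i.2|)) (-(|p (i.2 + 1)|))

/-- A finite sequence of indices is admissible if consecutively the range of
each inverse branch is contained in the domain of the previous one, i.e.
`J (i_l) ⊆ F (J (i_(l-1))) = f^(2^(|i_(l-1)|)) (J (i_(l-1)))`. -/
def Admissible (f : ℝ → ℝ) (p : ℕ → ℝ) : List (Bool × ℕ) → Prop
  | [] => True
  | [_] => True
  | i :: j :: w => Jint p j ⊆ f^[2 ^ i.2] '' Jint p i ∧ Admissible f p (j :: w)

/-- `gbr i` is the inverse branch `(F|J i)⁻¹` of the induced Markov map `F`,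
where `F = f^(2^(|i|))` on `J i`. -/
def InvBranches (f : ℝ → ℝ) (p : ℕ → ℝ) (gbr : Bool × ℕ → ℝ → ℝ) : Prop :=
  ∀ i : Bool × ℕ,
    (∀ x ∈ Jint p i, gbr i (f^[2 ^ i.2] x) = x) ∧
    MapsTo (gbr i) (f^[2 ^ i.2] '' Jint p i) (Jint p i)

/-- The composed inverse branch `g_w = g_(i₀) ∘ g_(i₁) ∘ ⋯ ∘ g_(i_(k-1))`. -/
def gComp (gbr : Bool × ℕ → ℝ → ℝ) : List (Bool × ℕ) → ℝ → ℝ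
  | [] => id
  | i :: w => gbr i ∘ gComp gbr w

/-- The domain `D(g_w)` of the composed inverse branch: the domain
`F (J (i_(k-1)))` of the last branch. -/
noncomputable def DomG (f : ℝ → ℝ) (p : ℕ → ℝ) (w : List (Bool × ℕ)) : Set ℝ :=
  match w.getLast? with
  | none => ∅
  | some i => f^[2 ^ i.2] '' Jint p i

/-- The length of a set of reals. -/
noncomputable def len (S : Set ℝ) : ℝ := (volume S).toReal

/-- The induced Markov map has the bounded distortion property. -/
def BoundedDistortion (f : ℝ → ℝ) (p : ℕ → ℝ) (gbr : Bool × ℕ → ℝ → ℝ) : Prop :=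
  ∃ C > 0,
    (∀ n : ℕ, ∀ s : Bool,
      C ≤ len (Jint p (s, n)) / ∑' l : ℕ, len (Jint p (s, n + 1 + l))) ∧
    (∀ w : List (Bool × ℕ), w ≠ [] → Admissible f p w →
      ∀ x ∈ DomG f p w, |Nonlin (gComp gbr w) x| ≤ C / len (DomG f p w))

/-- `H` is quasisymmetric on `[-1,1]`. -/
def QuasiSymmetric (H : ℝ → ℝ) : Prop :=
  ∃ M > 0, ∀ x ∈ Icc (-1 : ℝ) 1, ∀ y ∈ Icc (-1 : ℝ) 1, x ≠ y →
    M⁻¹ ≤ |H x - H ((x + y) / 2)| / |H ((x + y) / 2) - H y| ∧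
    |H x - H ((x + y) / 2)| / |H ((x + y) / 2) - H y| ≤ M

/-- `H` is a homeomorphism of `[-1,1]` onto itself. -/
def IntervalHomeo (H : ℝ → ℝ) : Prop :=
  ContinuousOn H (Icc (-1) 1) ∧ BijOn H (Icc (-1) 1) (Icc (-1) 1)

namespace NegSchwDiffeo

variable {h : ℝ → ℝ}

theorem contDiffAt (hh : NegSchwDiffeo h) {x : ℝ} (hx : x ∈ Ioo (-1 : ℝ) 0) :
    ContDiffAt ℝ 3 h x :=
  hh.1.contDiffAt (Icc_mem_nhds hx.1 hx.2)

theorem hasDerivAt (hh : NegSchwDiffeo h) {x : ℝ} (hx : x ∈ Ioo (-1 : ℝ) 0) :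
    HasDerivAt h (deriv h x) x :=
  ((hh.contDiffAt hx).differentiableAt (by norm_num)).hasDerivAt

theorem contDiffAt_deriv (hh : NegSchwDiffeo h) {x : ℝ} (hx : x ∈ Ioo (-1 : ℝ) 0) :
    ContDiffAt ℝ 2 (deriv h) x := by
  have h3 : ContDiffOn ℝ 3 h (Ioo (-1) 0) := hh.1.mono Ioo_subset_Icc_self
  exact (h3.deriv_of_isOpen isOpen_Ioo (m := 2) (by norm_num)).contDiffAt
    (isOpen_Ioo.mem_nhds hx)

theorem contDiffAt_deriv_deriv (hh : NegSchwDiffeo h) {x : ℝ} (hx : x ∈ Ioo (-1 : ℝ) 0) :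
    ContDiffAt ℝ 1 (deriv (deriv h)) x := by
  have h2 : ContDiffOn ℝ 2 (deriv h) (Ioo (-1) 0) :=
    fun y hy => (hh.contDiffAt_deriv hy).contDiffWithinAt
  exact (h2.deriv_of_isOpen isOpen_Ioo (m := 1) (by norm_num)).contDiffAt
    (isOpen_Ioo.mem_nhds hx)

theorem hasDerivAt_deriv (hh : NegSchwDiffeo h) {x : ℝ} (hx : x ∈ Ioo (-1 : ℝ) 0) :
    HasDerivAt (deriv h) (deriv (deriv h) x) x :=
  ((hh.contDiffAt_deriv hx).differentiableAt (by norm_num)).hasDerivAt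

theorem hasDerivAt_deriv_deriv (hh : NegSchwDiffeo h) {x : ℝ} (hx : x ∈ Ioo (-1 : ℝ) 0) :
    HasDerivAt (deriv (deriv h)) (deriv (deriv (deriv h)) x) x :=
  ((hh.contDiffAt_deriv_deriv hx).differentiableAt (by norm_num)).hasDerivAt

theorem deriv_pos (hh : NegSchwDiffeo h) {x : ℝ} (hx : x ∈ Ioo (-1 : ℝ) 0) :
    0 < deriv h x :=
  hh.2.1 x (Ioo_subset_Icc_self hx)

/-- Nonpositive Schwarzian derivative means that `(h')^(-1/2)` is convex. -/
theorem convexOn_rpow_deriv (hh : NegSchwDiffeo h) :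
    ConvexOn ℝ (Ioo (-1) 0) (fun x => deriv h x ^ (-(1 / 2) : ℝ)) := by
  have d1 : ∀ x ∈ Ioo (-1 : ℝ) 0, HasDerivAt (fun x => deriv h x ^ (-(1 / 2) : ℝ))
      (-(1 / 2) * (deriv (deriv h) x * deriv h x ^ (-(3 / 2) : ℝ))) x := by
    intro x hx
    convert (hh.hasDerivAt_deriv hx).rpow_const (p := -(1 / 2)) (Or.inl (hh.deriv_pos hx).ne')
      using 1
    norm_num
    ring
  have d2 : ∀ x ∈ Ioo (-1 : ℝ) 0,
      HasDerivAt (fun x => -(1 / 2) * (deriv (deriv h) x * deriv h x ^ (-(3 / 2) : ℝ)))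
        (-(1 / 2) * (deriv (deriv (deriv h)) x * deriv h x ^ (-(3 / 2) : ℝ) +
          deriv (deriv h) x *
            (deriv (deriv h) x * (-(3 / 2)) * deriv h x ^ (-(3 / 2) - 1 : ℝ)))) x :=
    fun x hx => ((hh.hasDerivAt_deriv_deriv hx).mul ((hh.hasDerivAt_deriv hx).rpow_const
      (Or.inl (hh.deriv_pos hx).ne'))).const_mul _
  refine convexOn_of_hasDerivWithinAt2_nonneg (convex_Ioo _ _)
    (fun x hx => (d1 x hx).continuousAt.continuousWithinAt)
    (fun x hx => (d1 x (interior_subset hx)).hasDerivWithinAt)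
    (fun x hx => (d2 x (interior_subset hx)).hasDerivWithinAt) ?_
  intro x hx
  have hx := interior_subset hx
  have hp := hh.deriv_pos hx
  have hS := hh.2.2 x (Ioo_subset_Icc_self hx)
  unfold Schw at hS
  have e1 : deriv h x ^ (-(3 / 2) : ℝ) = deriv h x ^ (-(1 / 2) : ℝ) / deriv h x := by
    rw [← Real.rpow_sub_one hp.ne']; norm_num
  rw [Real.rpow_sub_one hp.ne', e1]
  have hpos : 0 < deriv h x ^ (-(1 / 2) : ℝ) := Real.rpow_pos_of_pos hp _
  have key : -(1 / 2) * (deriv (deriv (deriv h)) x * (deriv h x ^ (-(1 / 2) : ℝ) / deriv h x) +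
      deriv (deriv h) x * (deriv (deriv h) x * (-(3 / 2)) *
        (deriv h x ^ (-(1 / 2) : ℝ) / deriv h x / deriv h x))) =
      (1 / 2) * deriv h x ^ (-(1 / 2) : ℝ) * -(deriv (deriv (deriv h)) x / deriv h x -
        3 / 2 * (deriv (deriv h) x / deriv h x) ^ 2) := by
    field_simp
    ring
  rw [key]
  exact mul_nonneg (by positivity) (by linarith)

/-- A map with nonpositive Schwarzian derivative agrees with the inverse branch of `Q_t` in at
most three negative points. -/
theorem not_four_eq_neg_rpow (hh : NegSchwDiffeo h) {a : ℝ} (ha0 : 0 < a) (ha1 : a < 1)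
    {y₀ y₁ y₂ y₃ : ℝ} (hy₀ : -1 ≤ y₀) (h01 : y₀ < y₁) (h12 : y₁ < y₂) (h23 : y₂ < y₃)
    (hy₃ : y₃ < 0) (e : ∀ y ∈ ({y₀, y₁, y₂, y₃} : Set ℝ), h y = -(-y) ^ a) : False := by
  have rolle : ∀ u v : ℝ, -1 ≤ u → u < v → v < 0 → h u = -(-u) ^ a → h v = -(-v) ^ a →
      ∃ z ∈ Ioo u v, deriv h z = a * (-z) ^ (a - 1) := by
    intro u v hu huv hv eu ev
    have hcont : ContinuousOn (fun y => h y + (-y) ^ a) (Icc u v) :=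
      (hh.1.continuousOn.mono (Icc_subset_Icc hu hv.le)).add
        (continuousOn_id.neg.rpow_const fun _ _ => Or.inr ha0.le)
    have hder : ∀ x ∈ Ioo u v, HasDerivAt (fun y => h y + (-y) ^ a)
        (deriv h x + -1 * a * (-x) ^ (a - 1)) x := fun x hx =>
      (hh.hasDerivAt ⟨by linarith [hx.1], by linarith [hx.2]⟩).add
        ((hasDerivAt_neg x).rpow_const (Or.inl (by linarith [hx.2])))
    obtain ⟨z, hz, hz'⟩ := exists_hasDerivAt_eq_zero huv hcont (by simp only [eu, ev]; ring) hder
    exact ⟨z, hz, by linarith⟩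
  obtain ⟨z₀, hz₀, k₀⟩ := rolle y₀ y₁ hy₀ h01 (by linarith) (e _ (by simp)) (e _ (by simp))
  obtain ⟨z₁, hz₁, k₁⟩ := rolle y₁ y₂ (by linarith) h12 (by linarith) (e _ (by simp))
    (e _ (by simp))
  obtain ⟨z₂, hz₂, k₂⟩ := rolle y₂ y₃ (by linarith) h23 hy₃ (e _ (by simp)) (e _ (by simp))
  have hval : ∀ z < 0, deriv h z = a * (-z) ^ (a - 1) →
      deriv h z ^ (-(1 / 2) : ℝ) = a ^ (-(1 / 2) : ℝ) * (-z) ^ ((1 - a) / 2) := by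
    intro z hz hd
    have hz : 0 < -z := by linarith
    rw [hd, Real.mul_rpow ha0.le (by positivity), ← Real.rpow_mul hz.le]
    congr 2
    ring
  have l01 : z₀ < z₁ := hz₀.2.trans hz₁.1
  have l12 : z₁ < z₂ := hz₁.2.trans hz₂.1
  have n2 : z₂ < 0 := hz₂.2.trans hy₃
  have n0 : -1 < z₀ := hy₀.trans_lt hz₀.1
  set s := (z₂ - z₁) / (z₂ - z₀) with hs
  have hD : 0 < z₂ - z₀ := by linarith
  have hs0 : 0 < s := div_pos (by linarith) hD
  have hs1 : 0 < 1 - s := by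
    rw [hs, sub_pos, div_lt_one hD]; linarith
  have hsz : s * z₀ + (1 - s) * z₂ = z₁ := by
    rw [hs]; field_simp; ring
  have hconv := hh.convexOn_rpow_deriv.2 (x := z₀) (y := z₂) ⟨n0, by linarith⟩
    ⟨by linarith, n2⟩ hs0.le hs1.le (by ring)
  have hconc := (Real.strictConcaveOn_rpow (p := (1 - a) / 2) (by linarith) (by linarith)).2
    (x := -z₀) (y := -z₂) (show (0 : ℝ) ≤ -z₀ by linarith) (show (0 : ℝ) ≤ -z₂ by linarith)
    (by intro h; linarith) hs0 hs1 (by ring)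
  simp only [smul_eq_mul] at hconv hconc
  rw [hsz, hval _ (by linarith) k₀, hval _ (by linarith) k₁, hval _ n2 k₂] at hconv
  rw [show s * -z₀ + (1 - s) * -z₂ = -z₁ by linarith] at hconc
  have hapos : 0 < a ^ (-(1 / 2) : ℝ) := Real.rpow_pos_of_pos ha0 _
  nlinarith [mul_lt_mul_of_pos_left hconc hapos]

/-- `1 / h'` is `K`-Lipschitz when the nonlinearity is bounded by `K`. -/
theorem inv_deriv_le (hh : NegSchwDiffeo h) {K : ℝ}
    (hN : ∀ x ∈ Icc (-1 : ℝ) 0, |Nonlin h x| ≤ K) {x y : ℝ} (hx : -1 < x) (hxy : x ≤ y)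
    (hy : y < 0) : (deriv h x)⁻¹ ≤ (deriv h y)⁻¹ + K * (y - x) := by
  have := (convex_Ioo (-1 : ℝ) 0).norm_image_sub_le_of_norm_hasDerivWithin_le
    (f := fun x => (deriv h x)⁻¹) (f' := fun x => -deriv (deriv h) x / deriv h x ^ 2) (C := K)
    (fun z hz => ((hh.hasDerivAt_deriv hz).inv (hh.deriv_pos hz).ne').hasDerivWithinAt)
    (fun z hz => by
      have := hN z (Ioo_subset_Icc_self hz)
      unfold Nonlin at this
      rwa [Real.norm_eq_abs, neg_div, abs_neg])
    (x := y) (y := x) ⟨by linarith, hy⟩ ⟨hx, by linarith⟩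
  rw [Real.norm_eq_abs, Real.norm_eq_abs, abs_sub_comm x y, abs_of_nonneg (sub_nonneg.2 hxy)]
    at this
  linarith [le_abs_self ((deriv h x)⁻¹ - (deriv h y)⁻¹)]

/-- With bounded nonlinearity, a large derivative forces a large image. -/
theorem mul_le_exp_of_image_le (hh : NegSchwDiffeo h) {K : ℝ} (hK : 0 < K)
    (hN : ∀ x ∈ Icc (-1 : ℝ) 0, |Nonlin h x| ≤ K) {y : ℝ} (hy : y ∈ Ioo (-1 : ℝ) 0)
    (him : h y - h (-1) ≤ 2) : K * (y + 1) ≤ (deriv h y)⁻¹ * Real.exp (2 * K) := by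
  set m := (deriv h y)⁻¹ with hm
  have hm0 : 0 < m := inv_pos.2 (hh.deriv_pos hy)
  have hlin : ∀ x ≤ y, 0 < m + K * (y - x) := fun x hx => by
    have := mul_nonneg hK.le (sub_nonneg.2 hx)
    linarith
  have hlinder : ∀ x, HasDerivAt (fun x => m + K * (y - x)) (-K) x := fun x => by
    simpa using (((hasDerivAt_id x).const_sub y).const_mul K).const_add m
  have hmono : MonotoneOn (fun x => h x + 1 / K * Real.log (m + K * (y - x))) (Icc (-1) y) := by
    refine monotoneOn_of_hasDerivWithinAt_nonneg (convex_Icc _ _) ?_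
      (f' := fun x => deriv h x + 1 / K * (-K / (m + K * (y - x)))) ?_ ?_
    · refine (hh.1.continuousOn.mono (Icc_subset_Icc le_rfl hy.2.le)).add
        (continuousOn_const.mul (ContinuousOn.log ?_ fun x hx => (hlin x hx.2).ne'))
      fun_prop
    · intro x hx
      rw [interior_Icc] at hx
      exact ((hh.hasDerivAt ⟨hx.1, hx.2.trans hy.2⟩).add
        (((hlinder x).log (hlin x hx.2.le).ne').const_mul _)).hasDerivWithinAt
    · intro x hx
      rw [interior_Icc] at hx
      have hp := hh.deriv_pos ⟨hx.1, hx.2.trans hy.2⟩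
      have h1 := hh.inv_deriv_le hN hx.1 hx.2.le hy.2
      have h2 : (m + K * (y - x))⁻¹ ≤ deriv h x := inv_le_of_inv_le₀ hp h1
      have h3 : 1 / K * (-K / (m + K * (y - x))) = -(m + K * (y - x))⁻¹ := by
        field_simp
      rw [h3]
      linarith
  have hle := hmono (left_mem_Icc.2 hy.1.le) (right_mem_Icc.2 hy.1.le) hy.1.le
  simp only [sub_self, mul_zero, add_zero, sub_neg_eq_add] at hle
  have hpos : 0 < m + K * (y + 1) := by simpa using hlin (-1) hy.1.le
  have hlog : Real.log (m + K * (y + 1)) ≤ Real.log (m * Real.exp (2 * K)) := by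
    rw [Real.log_mul hm0.ne' (Real.exp_pos _).ne', Real.log_exp]
    have : 1 / K * (Real.log (m + K * (y + 1)) - Real.log m) ≤ 2 := by linarith
    rw [one_div, inv_mul_le_iff₀ hK] at this
    linarith
  have := (Real.log_le_log_iff hpos (by positivity)).1 hlog
  linarith

end NegSchwDiffeo

namespace Unimodal

variable {g : ℝ → ℝ}

theorem le_apply_zero (hg : Unimodal g) {x : ℝ} (hx : x ∈ Icc (-1 : ℝ) 1) : g x ≤ g 0 := by
  obtain ⟨-, hmono, hanti, -⟩ := hg
  rcases le_total x 0 with h | h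
  · exact hmono.monotoneOn ⟨hx.1, h⟩ ⟨by norm_num, le_rfl⟩ h
  · exact hanti.antitoneOn ⟨le_rfl, by norm_num⟩ ⟨h, hx.2⟩ h

theorem mapsTo (hg : Unimodal g) : MapsTo g (Icc (-1) 1) (Icc (-1) 1) := hg.2.2.2.2.2.2

/-- If the critical value is nonpositive, periodic points of period two are nonpositive. -/
theorem nonpos_of_iterate_two (hg : Unimodal g) (h0 : g 0 ≤ 0) {x : ℝ}
    (hx : x ∈ Icc (-1 : ℝ) 1) (h2 : g^[2] x = x) : x ≤ 0 :=
  calc x = g (g x) := h2.symm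
    _ ≤ g 0 := hg.le_apply_zero (hg.mapsTo hx)
    _ ≤ 0 := h0

/-- If the critical value is nonpositive, periodic points of period two are fixed. -/
theorem isFixed_of_iterate_two (hg : Unimodal g) (h0 : g 0 ≤ 0) {x : ℝ}
    (hx : x ∈ Icc (-1 : ℝ) 0) (h2 : g^[2] x = x) : g x = x := by
  have hx1 : x ∈ Icc (-1 : ℝ) 1 := ⟨hx.1, hx.2.trans zero_le_one⟩
  have hgx : g x ∈ Icc (-1 : ℝ) 0 := ⟨(hg.mapsTo hx1).1, (hg.le_apply_zero hx1).trans h0⟩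
  change g (g x) = x at h2
  rcases lt_trichotomy (g x) x with h | h | h
  · linarith [hg.2.1 hgx hx h]
  · exact h
  · linarith [hg.2.1 hx hgx h]

/-- Fixed points of a renormalization are rescaled points of period two. -/
theorem iterate_two_of_renorm2 {q x : ℝ} (hq : q ≠ 0) (h : Renorm2 g q x = x) :
    g^[2] (-q * x) = -q * x := by
  unfold Renorm2 at h
  rw [div_eq_iff hq] at h
  linarith

theorem isFixed_of_renorm2 (hg : Unimodal g) (h0 : g 0 ≤ 0) {q x : ℝ} (hq : q ∈ Ioo (-1 : ℝ) 0)
    (hx : x ∈ Icc (-1 : ℝ) 0) (h : Renorm2 g q x = x) : g (-q * x) = -q * x :=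
  hg.isFixed_of_iterate_two h0 ⟨by nlinarith [hq.1, hq.2, hx.1, hx.2],
    by nlinarith [hq.1, hq.2, hx.1, hx.2]⟩ (iterate_two_of_renorm2 hq.2.ne h)

end Unimodal

namespace FeigSeq

variable {f : ℝ → ℝ} {fs : ℕ → ℝ → ℝ} {qs : ℕ → ℝ}

theorem qs_mem (hF : FeigSeq f fs qs) (k : ℕ) : qs k ∈ Ioo (-1 : ℝ) 1 :=
  abs_lt.1 (hF.2 k).2.2.1

theorem qs_mem_Ioo_of_nonpos (hF : FeigSeq f fs qs) {k : ℕ} (h0 : fs k 0 ≤ 0) :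
    qs k ∈ Ioo (-1 : ℝ) 0 := by
  have hq := hF.qs_mem k
  have := (hF.2 k).1.nonpos_of_iterate_two h0 ⟨hq.1.le, hq.2.le⟩ (hF.2 k).2.2.2.1
  exact ⟨hq.1, this.lt_of_ne (abs_pos.1 (hF.2 k).2.1)⟩

theorem isFixed_qs_of_nonpos (hF : FeigSeq f fs qs) {k : ℕ} (h0 : fs k 0 ≤ 0) :
    fs k (qs k) = qs k := by
  have hq := hF.qs_mem_Ioo_of_nonpos h0
  exact (hF.2 k).1.isFixed_of_iterate_two h0 ⟨hq.1.le, hq.2.le⟩ (hF.2 k).2.2.2.1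

theorem succ_nonpos (hF : FeigSeq f fs qs) {k : ℕ} (h0 : fs k 0 ≤ 0) : fs (k + 1) 0 ≤ 0 := by
  have hq := hF.qs_mem_Ioo_of_nonpos h0
  have hU := (hF.2 k).1
  have : fs k (fs k 0) ≤ 0 := (hU.le_apply_zero (hU.mapsTo (by norm_num))).trans h0
  rw [(hF.2 k).2.2.2.2.2]
  simp only [Renorm2, mul_zero, Function.iterate_succ, Function.iterate_zero, Function.comp, id]
  exact div_nonpos_of_nonneg_of_nonpos (by linarith) hq.2.le

/-- A period-doubling cascade with nonpositive critical value has at least four fixed points. -/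
theorem exists_fixed_of_nonpos (hF : FeigSeq f fs qs) (h0 : f 0 ≤ 0) :
    ∃ x₁ x₂ x₃ : ℝ, -1 < x₁ ∧ x₁ < x₂ ∧ x₂ < x₃ ∧ x₃ < 0 ∧ f x₁ = x₁ ∧ f x₂ = x₂ ∧ f x₃ = x₃ := by
  have z0 : fs 0 0 ≤ 0 := by rwa [hF.1]
  have z1 : fs 1 0 ≤ 0 := hF.succ_nonpos z0
  have z2 : fs 2 0 ≤ 0 := hF.succ_nonpos z1
  have m0 := hF.qs_mem_Ioo_of_nonpos z0
  have m1 := hF.qs_mem_Ioo_of_nonpos z1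
  have m2 := hF.qs_mem_Ioo_of_nonpos z2
  have lift : ∀ k, fs k 0 ≤ 0 → qs k ∈ Ioo (-1 : ℝ) 0 → ∀ x ∈ Ioo (-1 : ℝ) 0,
      fs (k + 1) x = x → fs k (-qs k * x) = -qs k * x := fun k hk hq x hx e =>
    (hF.2 k).1.isFixed_of_renorm2 hk hq ⟨hx.1.le, hx.2.le⟩ (by rwa [← (hF.2 k).2.2.2.2.2])
  have scale : ∀ q ∈ Ioo (-1 : ℝ) 0, ∀ x ∈ Ioo (-1 : ℝ) 0, -q * x ∈ Ioo q 0 := fun q hq x hx =>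
    ⟨by nlinarith [hq.2, hx.1], by nlinarith [hq.2, hx.2]⟩
  have s12 := scale _ m1 _ m2
  have s12' : -qs 1 * qs 2 ∈ Ioo (-1 : ℝ) 0 := ⟨m1.1.trans s12.1, s12.2⟩
  refine ⟨qs 0, -qs 0 * qs 1, -qs 0 * (-qs 1 * qs 2), m0.1, (scale _ m0 _ m1).1,
    mul_lt_mul_of_pos_left s12.1 (by linarith [m0.2]), (scale _ m0 _ s12').2, ?_⟩
  rw [← hF.1]
  exact ⟨hF.isFixed_qs_of_nonpos z0, lift 0 z0 m0 _ m1 (hF.isFixed_qs_of_nonpos z1),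
    lift 0 z0 m0 _ s12' (lift 1 z1 m1 _ m2 (hF.isFixed_qs_of_nonpos z2))⟩

/-- The first rescaled map is increasing exactly where `f²` is monotone on the restrictive
interval. -/
theorem iterate_two_mul_lt (hF : FeigSeq f fs qs) {x y : ℝ} (hx : -1 ≤ x) (hxy : x < y)
    (hy : y ≤ 0) : -(f (f (-qs 0 * x))) / qs 0 < -(f (f (-qs 0 * y))) / qs 0 := by
  have h := (hF.2 1).1.2.1 (show x ∈ Icc (-1 : ℝ) 0 from ⟨hx, by linarith⟩)
    (show y ∈ Icc (-1 : ℝ) 0 from ⟨by linarith, hy⟩) hxy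
  rw [show (1 : ℕ) = 0 + 1 from rfl, (hF.2 0).2.2.2.2.2, hF.1] at h
  exact h

theorem unimodal (hF : FeigSeq f fs qs) : Unimodal f := hF.1 ▸ (hF.2 0).1

theorem qs_zero_pos (hF : FeigSeq f fs qs) (hc : 0 < f 0) : 0 < qs 0 := by
  by_contra! hle
  have hq : qs 0 < 0 := hle.lt_of_ne (abs_pos.1 (hF.2 0).2.1)
  have hq1 := (hF.qs_mem 0).1
  have hU := hF.unimodal
  have hcont : ContinuousWithinAt f (Icc (-1) 0) 0 :=
    (hU.1 0 (by norm_num)).mono (Icc_subset_Icc le_rfl zero_le_one)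
  have hcont' : ContinuousWithinAt f (Iio 0) 0 := by
    refine hcont.mono_of_mem_nhdsWithin ?_
    filter_upwards [Ioo_mem_nhdsLT (show (-1 : ℝ) < 0 by norm_num)] with x hx
    exact ⟨hx.1.le, hx.2.le⟩
  obtain ⟨x, hx, hxq⟩ :=
    ((hcont'.eventually (lt_mem_nhds hc)).and (Ioo_mem_nhdsLT hq)).exists
  have hx1 : x ∈ Icc (-1 : ℝ) 0 := ⟨by linarith [hxq.1], hxq.2.le⟩
  have hlt : f x < f 0 := hU.2.1 hx1 (by norm_num) hxq.2
  have hc1 : f 0 ≤ 1 := (hU.mapsTo (by norm_num : (0 : ℝ) ∈ Icc (-1 : ℝ) 1)).2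
  have hff : f (f 0) < f (f x) := hU.2.2.1 ⟨hx.le, hlt.le.trans hc1⟩ ⟨hc.le, hc1⟩ hlt
  have hdiv : -qs 0 * (-x / qs 0) = x := by
    have := hq.ne
    field_simp
  have hmono := hF.iterate_two_mul_lt (x := -x / qs 0) (y := 0)
    (by rw [le_div_iff_of_neg hq]; linarith [hxq.1])
    (div_neg_of_pos_of_neg (by linarith [hxq.2]) hq) le_rfl
  rw [hdiv, mul_zero, div_lt_div_right_of_neg hq] at hmono
  linarith

theorem apply_qs_zero_nonneg (hF : FeigSeq f fs qs) (hc : 0 < f 0) : 0 ≤ f (qs 0) := by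
  by_contra! hneg
  have hq := hF.qs_zero_pos hc
  have hq1 := hF.qs_mem 0
  have hU := hF.unimodal
  obtain ⟨c, hcm, hc0⟩ := intermediate_value_Ioo' hq.le
    (hU.1.mono (Icc_subset_Icc (by norm_num) hq1.2.le)) ⟨hneg, hc⟩
  have hfq : f (f (qs 0)) < f 0 :=
    hU.2.1 ⟨(hU.mapsTo ⟨hq1.1.le, hq1.2.le⟩).1, hneg.le⟩ (by norm_num) hneg
  have hdiv : -qs 0 * (-c / qs 0) = c := by field_simp
  have hmono := hF.iterate_two_mul_lt (x := -1) (y := -c / qs 0) le_rfl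
    (by rw [lt_div_iff₀ hq]; linarith [hcm.2])
    (div_nonpos_of_nonpos_of_nonneg (by linarith [hcm.1]) hq.le)
  rw [hdiv, mul_neg_one, neg_neg, div_lt_div_iff_of_pos_right hq, hc0] at hmono
  linarith

/-- Some chord of `f` over `[0, f 0]` has slope at most `-1`. -/
theorem exists_chord (hF : FeigSeq f fs qs) (hc : 0 < f 0) :
    ∃ u v : ℝ, 0 ≤ u ∧ u < v ∧ v ≤ f 0 ∧ v - u ≤ f u - f v := by
  rcases le_or_gt (f (f 0)) 0 with h | h
  · exact ⟨0, f 0, le_rfl, hc, le_rfl, by linarith⟩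
  have hq := hF.qs_zero_pos hc
  have hU := hF.unimodal
  have hR : fs 1 = Renorm2 f (qs 0) := by simpa [hF.1] using (hF.2 0).2.2.2.2.2
  have hR0 : fs 1 0 ≤ 0 := by
    rw [hR]
    simp only [Renorm2, mul_zero, Function.iterate_succ, Function.iterate_zero, Function.comp, id]
    exact div_nonpos_of_nonpos_of_nonneg (by linarith) hq.le
  have m1 := hF.qs_mem_Ioo_of_nonpos hR0
  have hb2 : f (f (qs 0)) = qs 0 := by simpa [hF.1] using (hF.2 0).2.2.2.1
  have ha2 : f (f (-qs 0 * qs 1)) = -qs 0 * qs 1 :=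
    Unimodal.iterate_two_of_renorm2 hq.ne' (hR ▸ hF.isFixed_qs_of_nonpos hR0)
  have hb0 := hF.apply_qs_zero_nonneg hc
  have hb1 := (hF.qs_mem 0).2
  set b := qs 0
  set a := -b * qs 1 with ha
  have ha0 : 0 < a := by nlinarith [m1.2]
  have hab : a < b := by nlinarith [m1.1]
  have hfab : f b < f a := hU.2.2.1 ⟨ha0.le, by linarith⟩ ⟨hq.le, hb1.le⟩ hab
  have orbit : ∀ x, 0 < x → x < 1 → 0 ≤ f x → f (f x) = x → f x ≠ x →
      ∃ u v : ℝ, 0 ≤ u ∧ u < v ∧ v ≤ f 0 ∧ v - u ≤ f u - f v := by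
    intro x hx0 hx1 hfx h2 hne
    have hxm : x ∈ Icc (-1 : ℝ) 1 := ⟨by linarith, hx1.le⟩
    have hfx0 := hU.le_apply_zero hxm
    have hx0' := hU.le_apply_zero (hU.mapsTo hxm)
    rw [h2] at hx0'
    rcases hne.lt_or_gt with hlt | hlt
    · exact ⟨f x, x, hfx, hlt, hx0', by rw [h2]⟩
    · exact ⟨x, f x, hx0.le, hlt, hfx0, by rw [h2]⟩
  by_cases hfb : f b = b
  · exact orbit a ha0 (by linarith) (by linarith) ha2 (by intro h; linarith)
  · exact orbit b hq hb1 hb0 hb2 hfb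

end FeigSeq

theorem rpow_sub_rpow_le {t u v : ℝ} (ht : 1 ≤ t) (hu : 0 ≤ u) (huv : u < v) :
    v ^ t - u ^ t ≤ t * v ^ (t - 1) * (v - u) := by
  obtain ⟨z, hz, e⟩ := exists_hasDerivAt_eq_slope (fun x : ℝ => x ^ t)
    (fun x => t * x ^ (t - 1)) huv
    (continuousOn_id.rpow_const fun _ _ => Or.inr (by linarith))
    (fun x _ => Real.hasDerivAt_rpow_const (Or.inr ht))
  rw [eq_div_iff (by linarith)] at e
  rw [← e]
  have : z ^ (t - 1) ≤ v ^ (t - 1) :=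
    Real.rpow_le_rpow (by linarith [hz.1]) hz.2.le (by linarith)
  gcongr

theorem NegSchwDiffeo.lower_bound_of_chord {h : ℝ → ℝ} (hh : NegSchwDiffeo h) {t K c u v : ℝ}
    (ht : 1 < t) (hK : 0 < K) (hN : ∀ x ∈ Icc (-1 : ℝ) 0, |Nonlin h x| ≤ K)
    (him : ∀ y ∈ Icc (-1 : ℝ) 0, h y - h (-1) ≤ 2) (hc1 : c ≤ 1) (hu : 0 ≤ u) (huv : u < v)
    (hv : v ≤ c) (hchord : v - u ≤ h (-u ^ t) - h (-v ^ t)) :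
    (K / (t * Real.exp (2 * K) + K)) ^ (1 / (t - 1)) ≤ c := by
  have hv0 : 0 < v := by linarith
  have hc0 : 0 < c := by linarith
  have hlt : u ^ t < v ^ t := Real.rpow_lt_rpow hu huv (by linarith)
  have hut : 0 ≤ u ^ t := by positivity
  have hvt : v ^ t ≤ c ^ t := Real.rpow_le_rpow hv0.le hv (by linarith)
  have hct : c ^ t ≤ c ^ (t - 1) := Real.rpow_le_rpow_of_exponent_ge hc0 hc1 (by linarith)
  have hct1 : c ^ t ≤ 1 := Real.rpow_le_one hc0.le hc1 (by linarith)
  obtain ⟨y, hy, e⟩ := exists_hasDerivAt_eq_slope h (deriv h) (neg_lt_neg hlt)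
    (hh.1.continuousOn.mono (Icc_subset_Icc (by linarith) (by linarith)))
    (fun x hx => hh.hasDerivAt ⟨by linarith [hx.1], by linarith [hx.2]⟩)
  have hym : y ∈ Ioo (-1 : ℝ) 0 := ⟨by linarith [hy.1], by linarith [hy.2]⟩
  have hp := hh.deriv_pos hym
  have hinv : (deriv h y)⁻¹ ≤ t * c ^ (t - 1) := by
    rw [eq_div_iff (by linarith)] at e
    have h1 := rpow_sub_rpow_le ht.le hu huv
    have h2 : v ^ (t - 1) ≤ c ^ (t - 1) := Real.rpow_le_rpow hv0.le hv (by linarith)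
    have h3 : v ^ t - u ^ t ≤ t * c ^ (t - 1) * (v - u) := h1.trans (by gcongr)
    have h4 : v - u ≤ deriv h y * (t * c ^ (t - 1)) * (v - u) := by nlinarith
    have h5 : 1 ≤ deriv h y * (t * c ^ (t - 1)) :=
      le_of_mul_le_mul_right (by linarith) (sub_pos.2 huv)
    rwa [inv_le_iff_one_le_mul₀' hp]
  have hmain := hh.mul_le_exp_of_image_le hK hN hym (him y (Ioo_subset_Icc_self hym))
  have hmain' : K * (y + 1) ≤ t * c ^ (t - 1) * Real.exp (2 * K) :=
    hmain.trans (by gcongr)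
  have hfin : K / (t * Real.exp (2 * K) + K) ≤ c ^ (t - 1) := by
    rw [div_le_iff₀ (by positivity)]
    nlinarith [hy.1]
  calc (K / (t * Real.exp (2 * K) + K)) ^ (1 / (t - 1))
      ≤ (c ^ (t - 1)) ^ (1 / (t - 1)) := by
        apply Real.rpow_le_rpow (by positivity) hfin
        exact one_div_nonneg.2 (by linarith)
    _ = c := by
        rw [← Real.rpow_mul hc0.le, mul_one_div_cancel (by linarith), Real.rpow_one]

/-- **Lemma 3.** For fixed `t > 1` and `K > 0` there is `C₃ = C₃(t,K) > 0` such
that every Feigenbaum map `f = h ∘ Q_t` in the class `𝒦(t,K)` (i.e. with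
`|N(h)| ≤ K` on `[-1,0]`) satisfies `f 0 = c₁(f) ≥ C₃`. -/
theorem lemma3_critical_value_lower_bound (t K : ℝ) (ht : 1 < t) (hK : 0 < K) :
    ∃ C₃ > 0, ∀ f h : ℝ → ℝ,
      Unimodal f → NegSchwDiffeo h →
      (∀ x ∈ Icc (-1 : ℝ) 1, f x = h (Qmap t x)) →
      (∀ x ∈ Icc (-1 : ℝ) 0, |Nonlin h x| ≤ K) →
      Feigenbaum f →
      C₃ ≤ f 0 := by
  refine ⟨(K / (t * Real.exp (2 * K) + K)) ^ (1 / (t - 1)), by positivity, ?_⟩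
  rintro f h hU hh hf hN ⟨fs, qs, hF⟩
  have hfneg : ∀ x ∈ Icc (-1 : ℝ) 0, f x = h (-(-x) ^ t) := fun x hx => by
    rw [hf x ⟨hx.1, hx.2.trans zero_le_one⟩, Qmap, abs_of_nonpos hx.2]
  have hfpos : ∀ x ∈ Icc (0 : ℝ) 1, f x = h (-x ^ t) := fun x hx => by
    rw [hf x ⟨by linarith [hx.1], hx.2⟩, Qmap, abs_of_nonneg hx.1]
  have hc1 : f 0 ≤ 1 := (hU.mapsTo (by norm_num : (0 : ℝ) ∈ Icc (-1 : ℝ) 1)).2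
  rcases le_or_gt (f 0) 0 with hc | hc
  · exfalso
    obtain ⟨x₁, x₂, x₃, l0, l1, l2, l3, e1, e2, e3⟩ := hF.exists_fixed_of_nonpos hc
    have hmono : ∀ x y : ℝ, x < y → y < 0 → -(-x) ^ t < -(-y) ^ t := fun x y hxy hy =>
      neg_lt_neg (Real.rpow_lt_rpow (by linarith) (by linarith) (by linarith))
    have hpt : ∀ x, -1 ≤ x → x < 0 → f x = x →
        h (-(-x) ^ t) = -(-(-(-x) ^ t)) ^ (1 / t) := fun x hx hx0 e => by
      rw [← hfneg x ⟨hx, hx0.le⟩, e, neg_neg, ← Real.rpow_mul (by linarith),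
        mul_one_div_cancel (by linarith), Real.rpow_one, neg_neg]
    refine hh.not_four_eq_neg_rpow (a := 1 / t) (by positivity)
      (by rw [div_lt_one (by linarith)]; exact ht) (y₀ := -(-(-1)) ^ t) (by simp)
      (hmono _ _ l0 (by linarith)) (hmono _ _ l1 (by linarith)) (hmono _ _ l2 l3)
      (neg_lt_zero.2 (Real.rpow_pos_of_pos (by linarith) _)) ?_
    rintro y (rfl | rfl | rfl | rfl)
    · exact hpt _ le_rfl (by norm_num) hU.2.2.2.2.1
    · exact hpt _ l0.le (by linarith) e1
    · exact hpt _ (by linarith) (by linarith) e2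
    · exact hpt _ (by linarith) l3 e3
  · obtain ⟨u, v, hu, huv, hv, hchord⟩ := hF.exists_chord hc
    rw [hfpos u ⟨hu, by linarith⟩, hfpos v ⟨by linarith, by linarith⟩] at hchord
    have him : ∀ y ∈ Icc (-1 : ℝ) 0, h y - h (-1) ≤ 2 := fun y hy => by
      have hy0 : 0 ≤ -y := by linarith [hy.2]
      have hx : (-y) ^ (1 / t) ∈ Icc (0 : ℝ) 1 :=
        ⟨by positivity, Real.rpow_le_one hy0 (by linarith [hy.1]) (by positivity)⟩
      have e := hfpos _ hx
      rw [← Real.rpow_mul hy0, one_div_mul_cancel (by linarith), Real.rpow_one, neg_neg] at e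
      have e1 := hfpos 1 (by norm_num)
      rw [Real.one_rpow, hU.2.2.2.2.2.1] at e1
      rw [← e, ← e1]
      have := (hU.mapsTo (show (-y) ^ (1 / t) ∈ Icc (-1 : ℝ) 1 from
        ⟨by linarith [hx.1], hx.2⟩)).2
      linarith
    exact hh.lower_bound_of_chord ht hK hN him hc1 hu huv hv hchord
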